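/- Let p ∈ (1,∞) and let F be a nonempty subset of P_p(ℝ) that is displacement convex and closed with respect to the p-Wasserstein distance W_p. Then for every μ ∈ P_p(ℝ) there exists a unique ν̂ ∈ F such that W_p(ν̂, μ) = inf_{ν ∈ F} W_p(ν, μ). -/

import Mathlib

open MeasureTheory Set Filter

noncomputable def quantile (μ : MeasureTheory.Measure ℝ) (u : ℝ) : ℝ :=
  sInf {x : ℝ | u ≤ (μ (Set.Iic x)).toReal}

def HasFiniteMomentP (p : ℝ) (μ : MeasureTheory.Measure ℝ) : Prop :=
  MeasureTheory.IsProbabilityMeasure μ ∧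
    MeasureTheory.Integrable (fun x => |x| ^ p) μ

noncomputable def Wdist (p : ℝ) (μ ν : MeasureTheory.Measure ℝ) : ℝ :=
  (∫ u in Set.Ioo (0:ℝ) 1, |quantile μ u - quantile ν u| ^ p) ^ (1 / p)

def DisplacementConvex (F : Set (MeasureTheory.Measure ℝ)) : Prop :=
  ∀ μ ∈ F, ∀ ν ∈ F, ∀ t ∈ Set.Icc (0:ℝ) 1, ∃ σ ∈ F,
    ∀ u ∈ Set.Ioo (0:ℝ) 1,
      quantile σ u = (1 - t) * quantile μ u + t * quantile ν u

def WClosed (p : ℝ) (F : Set (MeasureTheory.Measure ℝ)) : Prop :=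
  ∀ (μs : ℕ → MeasureTheory.Measure ℝ) (μ : MeasureTheory.Measure ℝ),
    (∀ n, μs n ∈ F) → HasFiniteMomentP p μ →
    Filter.Tendsto (fun n => Wdist p (μs n) μ) Filter.atTop (nhds 0) → μ ∈ F

open ProbabilityTheory
open scoped Topology

/-! ### Uniform convexity of the `p`-th power -/

theorem abs_half_add_rpow_lt {p : ℝ} (hp : 1 < p) {a b : ℝ} (hab : a ≠ b) :
    |(a + b) / 2| ^ p < (|a| ^ p + |b| ^ p) / 2 := by
  by_cases h : |a| = |b|
  · obtain rfl : a = -b := (abs_eq_abs.1 h).resolve_left hab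
    have hb : 0 < |b| := abs_pos.2 fun hb => hab (by simp [hb])
    have := Real.rpow_pos_of_pos hb p
    simpa [Real.zero_rpow (by linarith : p ≠ 0)] using this
  · have hconv := (strictConvexOn_rpow hp).2 (abs_nonneg a) (abs_nonneg b) h
      (by norm_num : (0 : ℝ) < 1 / 2) (by norm_num : (0 : ℝ) < 1 / 2) (by norm_num)
    have hle : |(a + b) / 2| ≤ (1 / 2 : ℝ) • |a| + (1 / 2 : ℝ) • |b| := by
      rw [abs_div, abs_two, smul_eq_mul, smul_eq_mul]
      linarith [abs_add_le a b]
    have := Real.rpow_le_rpow (abs_nonneg _) hle (by linarith : 0 ≤ p)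
    simp only [smul_eq_mul] at hconv this
    linarith

theorem exists_abs_sub_rpow_le {p : ℝ} (hp : 1 < p) {ε : ℝ} (hε : 0 < ε) :
    ∃ C : ℝ, 0 ≤ C ∧ ∀ a b : ℝ, |a - b| ^ p ≤
      ε * (|a| ^ p + |b| ^ p) + C * ((|a| ^ p + |b| ^ p) / 2 - |(a + b) / 2| ^ p) := by
  have hp0 : 0 ≤ p := by linarith
  have hp0' : p ≠ 0 := by linarith
  have hcont : ∀ {f : ℝ × ℝ → ℝ}, Continuous f → Continuous fun x => |f x| ^ p := fun hf =>
    hf.abs.rpow_const fun _ => Or.inr hp0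
  set D : ℝ × ℝ → ℝ := fun x => (|x.1| ^ p + |x.2| ^ p) / 2 - |(x.1 + x.2) / 2| ^ p with hD
  have hDcont : Continuous D :=
    (((hcont continuous_fst).add (hcont continuous_snd)).div_const 2).sub
      (hcont (by fun_prop))
  have hDnonneg : ∀ x, 0 ≤ D x := by
    rintro ⟨a, b⟩
    by_cases h : a = b
    · simp [hD, h]
    · exact (sub_pos.2 (abs_half_add_rpow_lt hp h)).le
  let K : Set (ℝ × ℝ) := Metric.sphere 0 1 ∩ {x | ε ≤ |x.1 - x.2| ^ p}
  have hK : IsCompact K := (isCompact_sphere _ _).inter_right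
    (isClosed_le continuous_const (hcont (by fun_prop)))
  obtain ⟨δ, hδ, hδK⟩ : ∃ δ > 0, ∀ x ∈ K, δ ≤ D x := by
    rcases K.eq_empty_or_nonempty with h | h
    · exact ⟨1, one_pos, by simp [h]⟩
    · obtain ⟨x, hx, hmin⟩ := hK.exists_isMinOn h hDcont.continuousOn
      refine ⟨D x, sub_pos.2 (abs_half_add_rpow_lt hp fun hxx => ?_), hmin⟩
      have := hx.2
      simp only [mem_ofPred_eq, hxx, sub_self, abs_zero, Real.zero_rpow hp0'] at this
      linarith
  have hC : 0 ≤ 2 ^ p / δ := by positivity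
  have key : ∀ x ∈ Metric.sphere (0 : ℝ × ℝ) 1,
      |x.1 - x.2| ^ p ≤ ε * (|x.1| ^ p + |x.2| ^ p) + 2 ^ p / δ * D x := by
    intro x hx
    have hnorm : max |x.1| |x.2| = 1 := by simpa [Prod.norm_def] using hx
    have h1 : |x.1| ≤ 1 := hnorm ▸ le_max_left _ _
    have h2 : |x.2| ≤ 1 := hnorm ▸ le_max_right _ _
    have hsum : 1 ≤ |x.1| ^ p + |x.2| ^ p := by
      have n1 : 0 ≤ |x.1| ^ p := by positivity
      have n2 : 0 ≤ |x.2| ^ p := by positivity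
      rcases max_choice |x.1| |x.2| with h | h <;> rw [h] at hnorm <;>
        rw [hnorm, Real.one_rpow] <;> linarith
    by_cases hxK : ε ≤ |x.1 - x.2| ^ p
    · have hle : |x.1 - x.2| ^ p ≤ 2 ^ p := by
        refine Real.rpow_le_rpow (abs_nonneg _) ?_ hp0
        linarith [abs_sub x.1 x.2]
      have : 2 ^ p ≤ 2 ^ p / δ * D x := by
        calc (2 : ℝ) ^ p = 2 ^ p / δ * δ := by field_simp
          _ ≤ _ := by gcongr; exact hδK x ⟨hx, hxK⟩
      nlinarith
    · have := mul_nonneg hC (hDnonneg x)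
      nlinarith
  refine ⟨2 ^ p / δ, hC, fun a b => ?_⟩
  by_cases h0 : ((a, b) : ℝ × ℝ) = 0
  · obtain ⟨rfl, rfl⟩ : a = 0 ∧ b = 0 := by simpa using h0
    simp [Real.zero_rpow hp0']
  have hr : 0 < ‖((a, b) : ℝ × ℝ)‖ := norm_pos_iff.2 h0
  set r := ‖((a, b) : ℝ × ℝ)‖ with hr_def
  have hmem : (a / r, b / r) ∈ Metric.sphere (0 : ℝ × ℝ) 1 := by
    have : (a / r, b / r) = r⁻¹ • ((a, b) : ℝ × ℝ) := by
      simp [div_eq_inv_mul]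
    rw [mem_sphere_zero_iff_norm, this, norm_smul, norm_inv, Real.norm_of_nonneg hr.le,
      ← hr_def, inv_mul_cancel₀ hr.ne']
  have hscale : ∀ c : ℝ, |c / r| ^ p = |c| ^ p / r ^ p := fun c => by
    rw [abs_div, abs_of_pos hr, Real.div_rpow (abs_nonneg _) hr.le]
  have hkey := key _ hmem
  simp only [hD, ← sub_div, ← add_div, div_right_comm _ r 2, hscale] at hkey
  have hrp : 0 < r ^ p := Real.rpow_pos_of_pos hr p
  calc |a - b| ^ p = |a - b| ^ p / r ^ p * r ^ p := by field_simp
    _ ≤ _ := mul_le_mul_of_nonneg_right hkey hrp.le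
    _ = _ := by field_simp

/-! ### Uniform convexity of `L^p` -/

theorem toReal_eLpNorm_ofReal {α : Type*} [MeasurableSpace α] {m : Measure α} {p : ℝ}
    (hp : 0 < p) {f : α → ℝ} (hf : MemLp f (ENNReal.ofReal p) m) :
    (eLpNorm f (ENNReal.ofReal p) m).toReal = (∫ x, |f x| ^ p ∂m) ^ (1 / p) := by
  rw [hf.eLpNorm_eq_integral_rpow_norm (by simpa using hp) ENNReal.ofReal_ne_top,
    ENNReal.toReal_ofReal (by positivity), ENNReal.toReal_ofReal hp.le, one_div]
  rfl

theorem MeasureTheory.Lp.norm_rpow_eq_integral {α : Type*} [MeasurableSpace α] {m : Measure α}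
    {p : ℝ} (hp : 0 < p) (f : Lp ℝ (ENNReal.ofReal p) m) :
    ‖f‖ ^ p = ∫ x, |f x| ^ p ∂m := by
  rw [Lp.norm_def, toReal_eLpNorm_ofReal hp (Lp.memLp f), one_div,
    Real.rpow_inv_rpow (integral_nonneg fun x => by positivity) hp.ne']

theorem MeasureTheory.Lp.integrable_abs_rpow {α : Type*} [MeasurableSpace α] {m : Measure α}
    {p : ℝ} (hp : 0 < p) (f : Lp ℝ (ENNReal.ofReal p) m) :
    Integrable (fun x => |f x| ^ p) m := by
  have := (Lp.memLp f).integrable_norm_rpow (by simpa using hp) ENNReal.ofReal_ne_top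
  rwa [ENNReal.toReal_ofReal hp.le] at this

theorem MeasureTheory.Lp.exists_norm_sub_rpow_le {α : Type*} [MeasurableSpace α] (m : Measure α)
    {p : ℝ} (hp : 1 < p) {ε : ℝ} (hε : 0 < ε) :
    ∃ C : ℝ, 0 ≤ C ∧ ∀ f g : Lp ℝ (ENNReal.ofReal p) m, ‖f - g‖ ^ p ≤
      ε * (‖f‖ ^ p + ‖g‖ ^ p) +
        C * ((‖f‖ ^ p + ‖g‖ ^ p) / 2 - ‖(1 / 2 : ℝ) • (f + g)‖ ^ p) := by
  obtain ⟨C, hC, h⟩ := exists_abs_sub_rpow_le hp hε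
  refine ⟨C, hC, fun f g => ?_⟩
  have hp0 : 0 < p := by linarith
  simp only [Lp.norm_rpow_eq_integral hp0]
  have hf := Lp.integrable_abs_rpow hp0 f
  have hg := Lp.integrable_abs_rpow hp0 g
  have hfg := Lp.integrable_abs_rpow hp0 ((1 / 2 : ℝ) • (f + g))
  have hsum : Integrable (fun x => |f x| ^ p + |g x| ^ p) m := hf.add hg
  have hgap : Integrable (fun x => (|f x| ^ p + |g x| ^ p) / 2 -
      |((1 / 2 : ℝ) • (f + g) : Lp ℝ (ENNReal.ofReal p) m) x| ^ p) m :=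
    (hsum.div_const 2).sub hfg
  rw [← integral_add hf hg, ← integral_const_mul, ← integral_div,
    ← integral_sub (hsum.div_const 2) hfg, ← integral_const_mul,
    ← integral_add (hsum.const_mul ε) (hgap.const_mul C)]
  refine integral_mono_ae (Lp.integrable_abs_rpow hp0 (f - g))
    ((hsum.const_mul ε).add (hgap.const_mul C)) ?_
  filter_upwards [Lp.coeFn_sub f g, Lp.coeFn_add f g, Lp.coeFn_smul (1 / 2 : ℝ) (f + g)]
    with x hsub hadd hsmul
  have := h (f x) (g x)
  simpa only [hsub, hsmul, hadd, Pi.sub_apply, Pi.add_apply, Pi.smul_apply, smul_eq_mul,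
    one_div_mul_eq_div] using this

/-! ### Nearest points in closed convex sets -/

theorem existsUnique_forall_dist_le_of_uniformConvex {E : Type*} [NormedAddCommGroup E]
    [NormedSpace ℝ E] [CompleteSpace E] {p : ℝ} (hp : 0 < p)
    (hE : ∀ ε > 0, ∃ C : ℝ, 0 ≤ C ∧ ∀ f g : E, ‖f - g‖ ^ p ≤ ε * (‖f‖ ^ p + ‖g‖ ^ p) +
      C * ((‖f‖ ^ p + ‖g‖ ^ p) / 2 - ‖(1 / 2 : ℝ) • (f + g)‖ ^ p))
    {K : Set E} (hne : K.Nonempty) (hconv : Convex ℝ K) (hclosed : IsClosed K) (x : E) :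
    ∃! y, y ∈ K ∧ ∀ z ∈ K, dist y x ≤ dist z x := by
  set D := Metric.infDist x K with hD
  have hD0 : 0 ≤ D := Metric.infDist_nonneg
  have hle : ∀ y ∈ K, D ≤ ‖y - x‖ := fun y hy => by
    rw [← dist_eq_norm, dist_comm]
    exact Metric.infDist_le_dist_of_mem hy
  have key : ∀ η > 0, ∃ δ > 0, ∀ y ∈ K, ∀ z ∈ K, ‖y - x‖ ^ p ≤ D ^ p + δ →
      ‖z - x‖ ^ p ≤ D ^ p + δ → dist y z < η := by
    intro η hη
    have hηp : 0 < η ^ p := Real.rpow_pos_of_pos hη p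
    have hDp : 0 ≤ D ^ p := by positivity
    obtain ⟨C, hC, h⟩ := hE (η ^ p / (4 * (D ^ p + 1))) (by positivity)
    refine ⟨min 1 (η ^ p / (4 * (C + 1))), by positivity, fun y hy z hz hy' hz' => ?_⟩
    set δ := min 1 (η ^ p / (4 * (C + 1)))
    have hδ1 : δ ≤ 1 := min_le_left _ _
    have hδ2 : δ * (4 * (C + 1)) ≤ η ^ p :=
      (le_div_iff₀ (by positivity)).1 (min_le_right _ _)
    have hδ0 : 0 < δ := by positivity
    have hmid : D ^ p ≤ ‖(1 / 2 : ℝ) • ((y - x) + (z - x))‖ ^ p := by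
      have hm := hle _ (hconv hy hz (by norm_num : (0 : ℝ) ≤ 1 / 2)
        (by norm_num : (0 : ℝ) ≤ 1 / 2) (by norm_num))
      have heq : (1 / 2 : ℝ) • ((y - x) + (z - x)) =
          (1 / 2 : ℝ) • y + (1 / 2 : ℝ) • z - x := by module
      rw [heq]
      exact Real.rpow_le_rpow hD0 hm hp.le
    have hyz := h (y - x) (z - x)
    rw [sub_sub_sub_cancel_right] at hyz
    have h1 : η ^ p / (4 * (D ^ p + 1)) * (‖y - x‖ ^ p + ‖z - x‖ ^ p) ≤ η ^ p / 2 := by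
      calc _ ≤ η ^ p / (4 * (D ^ p + 1)) * (2 * (D ^ p + 1)) := by gcongr; linarith
        _ = _ := by field_simp; norm_num
    have h2 : C * ((‖y - x‖ ^ p + ‖z - x‖ ^ p) / 2 -
        ‖(1 / 2 : ℝ) • ((y - x) + (z - x))‖ ^ p) ≤ C * δ := by
      gcongr
      linarith
    rw [dist_eq_norm]
    refine (Real.rpow_lt_rpow_iff (norm_nonneg _) hη.le hp).1 ?_
    nlinarith
  have hunique : ∀ y ∈ K, ∀ z ∈ K, ‖y - x‖ ≤ D → ‖z - x‖ ≤ D → y = z := by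
    intro y hy z hz hy' hz'
    by_contra hyz
    obtain ⟨δ, hδ, h⟩ := key _ (dist_pos.2 hyz)
    refine lt_irrefl _ (h y hy z hz ?_ ?_) <;>
      refine (Real.rpow_le_rpow (norm_nonneg _) ‹_› hp.le).trans (by linarith)
  have hseq : ∀ n : ℕ, ∃ y ∈ K, dist x y < D + 1 / (n + 1) := fun n =>
    (Metric.infDist_lt_iff hne).1 (by rw [← hD]; linarith [Nat.one_div_pos_of_nat (α := ℝ) (n := n)])
  choose y hyK hy using hseq
  have hlim : Tendsto (fun n => ‖y n - x‖) atTop (𝓝 D) := by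
    refine tendsto_of_tendsto_of_tendsto_of_le_of_le tendsto_const_nhds
      (by simpa only [add_zero] using tendsto_one_div_add_atTop_nhds_zero_nat.const_add D)
      (fun n => hle _ (hyK n)) fun n => ?_
    rw [← dist_eq_norm, dist_comm]
    exact (hy n).le
  have hcauchy : CauchySeq y := by
    refine Metric.cauchySeq_iff.2 fun η hη => ?_
    obtain ⟨δ, hδ, h⟩ := key η hη
    have hev := (hlim.rpow_const (p := p) (Or.inr hp.le)).eventually_le_const
      (show D ^ p < D ^ p + δ by linarith)
    obtain ⟨N, hN⟩ := eventually_atTop.1 hev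
    exact ⟨N, fun m hm n hn => h _ (hyK m) _ (hyK n) (hN m hm) (hN n hn)⟩
  obtain ⟨z, hz⟩ := cauchySeq_tendsto_of_complete hcauchy
  have hzK : z ∈ K := hclosed.mem_of_tendsto hz (Eventually.of_forall hyK)
  have hzD : ‖z - x‖ = D := tendsto_nhds_unique (hz.sub_const x).norm hlim
  refine ⟨z, ⟨hzK, fun w hw => ?_⟩, fun w hw => ?_⟩
  · rw [dist_eq_norm, dist_eq_norm, hzD]
    exact hle w hw
  · refine hunique w hw.1 z hzK ?_ hzD.le
    rw [← hzD, ← dist_eq_norm, ← dist_eq_norm]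
    exact hw.2 z hzK

/-! ### Quantile functions -/

theorem quantile_le_iff (μ : Measure ℝ) [IsProbabilityMeasure μ] {u : ℝ} (hu : u ∈ Ioo (0 : ℝ) 1)
    (x : ℝ) : quantile μ u ≤ x ↔ u ≤ μ.real (Iic x) := by
  set S := {x : ℝ | u ≤ μ.real (Iic x)} with hS
  have hcdf : ∀ y, cdf μ y = μ.real (Iic y) := cdf_eq_real μ
  have hne : S.Nonempty := by
    obtain ⟨y, hy⟩ := ((tendsto_cdf_atTop μ).eventually_const_le hu.2).exists
    exact ⟨y, by rwa [hcdf] at hy⟩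
  have hbdd : BddBelow S := by
    obtain ⟨y, hy⟩ := ((tendsto_cdf_atBot μ).eventually_lt_const hu.1).exists
    refine ⟨y, fun z hz => le_of_not_gt fun hzy => ?_⟩
    have := monotone_cdf μ hzy.le
    rw [hcdf z] at this
    exact absurd (hz.trans this) (not_le.2 hy)
  change sInf S ≤ x ↔ x ∈ S
  refine ⟨fun h => ?_, fun h => csInf_le hbdd h⟩
  have hlim : Tendsto (cdf μ) (𝓝[>] x) (𝓝 (cdf μ x)) :=
    ((cdf μ).right_continuous x).mono_left (nhdsWithin_mono _ Ioi_subset_Ici_self)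
  have hev : ∀ᶠ y in 𝓝[>] x, u ≤ cdf μ y := by
    filter_upwards [self_mem_nhdsWithin] with y hy
    obtain ⟨z, hz, hzy⟩ := exists_lt_of_csInf_lt hne (h.trans_lt hy)
    have := monotone_cdf μ hzy.le
    rw [hcdf z] at this
    exact hz.trans this
  have := ge_of_tendsto hlim hev
  rwa [hcdf] at this

theorem monotoneOn_quantile (μ : Measure ℝ) [IsProbabilityMeasure μ] :
    MonotoneOn (quantile μ) (Ioo 0 1) := fun _ hu _ hv huv =>
  (quantile_le_iff μ hu _).2 (huv.trans ((quantile_le_iff μ hv _).1 le_rfl))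

theorem aemeasurable_quantile (μ : Measure ℝ) [IsProbabilityMeasure μ] :
    AEMeasurable (quantile μ) (volume.restrict (Ioo 0 1)) :=
  aemeasurable_restrict_of_monotoneOn measurableSet_Ioo (monotoneOn_quantile μ)

instance isProbabilityMeasure_volume_restrict_Ioo_zero_one :
    IsProbabilityMeasure (volume.restrict (Ioo (0 : ℝ) 1)) := ⟨by simp⟩

theorem map_quantile (μ : Measure ℝ) [IsProbabilityMeasure μ] :
    (volume.restrict (Ioo 0 1)).map (quantile μ) = μ := by
  have := Measure.isProbabilityMeasure_map (aemeasurable_quantile μ)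
  refine Measure.ext_of_Iic _ _ fun x => ?_
  rw [Measure.map_apply_of_aemeasurable (aemeasurable_quantile μ) measurableSet_Iic]
  have hae : quantile μ ⁻¹' Iic x =ᵐ[volume.restrict (Ioo 0 1)] Iic (μ.real (Iic x)) := by
    refine (ae_restrict_iff' measurableSet_Ioo).2 (Eventually.of_forall fun u hu => ?_)
    exact propext (quantile_le_iff μ hu x)
  have hIoc : Ioo (0 : ℝ) 1 =ᵐ[volume] Ioc 0 1 := Ioo_ae_eq_Ioc
  rw [measure_congr hae, Measure.restrict_congr_set hIoc,
    Measure.restrict_apply measurableSet_Iic, Iic_inter_Ioc_of_le measureReal_le_one,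
    Real.volume_Ioc, sub_zero, ofReal_measureReal]

theorem memLp_quantile {p : ℝ} (hp : 0 < p) {μ : Measure ℝ} (hμ : HasFiniteMomentP p μ) :
    MemLp (quantile μ) (ENNReal.ofReal p) (volume.restrict (Ioo 0 1)) := by
  have := hμ.1
  have hid : MemLp id (ENNReal.ofReal p) μ := by
    refine (integrable_norm_rpow_iff aestronglyMeasurable_id (by simpa using hp)
      ENNReal.ofReal_ne_top).1 ?_
    rw [ENNReal.toReal_ofReal hp.le]
    exact hμ.2
  rw [← map_quantile μ] at hid
  exact (memLp_map_measure_iff aestronglyMeasurable_id (aemeasurable_quantile μ)).1 hid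

theorem hasFiniteMomentP_map {p : ℝ} (hp : 0 < p) {g : ℝ → ℝ}
    (hg : MemLp g (ENNReal.ofReal p) (volume.restrict (Ioo 0 1))) :
    HasFiniteMomentP p ((volume.restrict (Ioo 0 1)).map g) := by
  refine ⟨Measure.isProbabilityMeasure_map hg.aemeasurable, ?_⟩
  have hid : MemLp id (ENNReal.ofReal p) ((volume.restrict (Ioo 0 1)).map g) :=
    (memLp_map_measure_iff aestronglyMeasurable_id hg.aemeasurable).2 hg
  have := hid.integrable_norm_rpow (by simpa using hp) ENNReal.ofReal_ne_top
  rwa [ENNReal.toReal_ofReal hp.le] at this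

/-- A function that is monotone up to a null set is a.e. the quantile function of its law. -/
theorem quantile_map_ae_eq {g : ℝ → ℝ} (hg : Integrable g (volume.restrict (Ioo 0 1))) {S : Set ℝ}
    (hS : ∀ᵐ u ∂volume.restrict (Ioo 0 1), u ∈ S) (hmono : MonotoneOn g S) :
    quantile ((volume.restrict (Ioo 0 1)).map g) =ᵐ[volume.restrict (Ioo 0 1)] g := by
  set ν := (volume.restrict (Ioo 0 1)).map g with hν
  have : IsProbabilityMeasure ν := Measure.isProbabilityMeasure_map hg.aemeasurable
  have hmap := map_quantile ν
  have hid : Integrable id ν :=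
    (integrable_map_measure aestronglyMeasurable_id hg.aemeasurable).2 hg
  have hint : Integrable (quantile ν) (volume.restrict (Ioo 0 1)) := by
    rw [← hmap] at hid
    exact (integrable_map_measure aestronglyMeasurable_id (aemeasurable_quantile ν)).1 hid
  refine (integral_eq_iff_of_ae_le hint hg ?_).1 ?_
  · filter_upwards [hS, ae_restrict_mem measurableSet_Ioo] with u huS hu
    refine (quantile_le_iff ν hu _).2 ?_
    rw [measureReal_def, hν,
      Measure.map_apply_of_aemeasurable hg.aemeasurable measurableSet_Iic]
    refine (ENNReal.ofReal_le_iff_le_toReal (measure_ne_top _ _)).1 ?_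
    have hIoc : Ioo (0 : ℝ) 1 =ᵐ[volume] Ioc 0 1 := Ioo_ae_eq_Ioc
    calc ENNReal.ofReal u = volume.restrict (Ioo 0 1) (Iic u) := by
          rw [Measure.restrict_congr_set hIoc, Measure.restrict_apply measurableSet_Iic,
            Iic_inter_Ioc_of_le hu.2.le, Real.volume_Ioc, sub_zero]
      _ ≤ volume.restrict (Ioo 0 1) (g ⁻¹' Iic (g u)) := by
          refine measure_mono_ae ?_
          filter_upwards [hS] with v hv hvu using hmono hv huS hvu
  · have h1 := integral_map (aemeasurable_quantile ν) (f := id) aestronglyMeasurable_id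
    have h2 := integral_map hg.aemeasurable (f := id) aestronglyMeasurable_id
    rw [hmap] at h1
    exact h1.symm.trans h2

/-! ### Embedding of the Wasserstein space into `L^p` -/

theorem eq_of_quantile_ae_eq {μ ν : Measure ℝ} [IsProbabilityMeasure μ] [IsProbabilityMeasure ν]
    (h : quantile μ =ᵐ[volume.restrict (Ioo 0 1)] quantile ν) : μ = ν := by
  rw [← map_quantile μ, ← map_quantile ν, Measure.map_congr h]

/-- The elements of `L^p(0,1)` represented by the quantile function of a member of `F`. -/
def quantileSet (p : ℝ) (F : Set (Measure ℝ)) :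
    Set (Lp ℝ (ENNReal.ofReal p) (volume.restrict (Ioo (0 : ℝ) 1))) :=
  {f | ∃ ν ∈ F, f =ᵐ[volume.restrict (Ioo 0 1)] quantile ν}

theorem DisplacementConvex.convex_quantileSet {p : ℝ} {F : Set (Measure ℝ)}
    (hF : DisplacementConvex F) : Convex ℝ (quantileSet p F) := by
  rintro f ⟨μ, hμ, hf⟩ g ⟨ν, hν, hg⟩ a b ha hb hab
  obtain ⟨σ, hσ, h⟩ := hF μ hμ ν hν b ⟨hb, by linarith⟩
  refine ⟨σ, hσ, ?_⟩
  filter_upwards [hf, hg, Lp.coeFn_add (a • f) (b • g), Lp.coeFn_smul a f, Lp.coeFn_smul b g,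
    ae_restrict_mem measurableSet_Ioo] with u hfu hgu hadd hfa hgb hu
  rw [hadd, Pi.add_apply, hfa, hgb, h u hu, Pi.smul_apply, Pi.smul_apply, hfu, hgu, smul_eq_mul,
    smul_eq_mul, ← hab, add_sub_cancel_right]

theorem dist_eq_Wdist {p : ℝ} (hp : 0 < p) {μ ν : Measure ℝ} (hμ : HasFiniteMomentP p μ)
    (hν : HasFiniteMomentP p ν) {f g : Lp ℝ (ENNReal.ofReal p) (volume.restrict (Ioo (0 : ℝ) 1))}
    (hf : f =ᵐ[volume.restrict (Ioo 0 1)] quantile μ)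
    (hg : g =ᵐ[volume.restrict (Ioo 0 1)] quantile ν) : dist f g = Wdist p μ ν := by
  rw [Lp.dist_def, eLpNorm_congr_ae (hf.sub hg), Wdist]
  exact toReal_eLpNorm_ofReal hp ((memLp_quantile hp hμ).sub (memLp_quantile hp hν))

theorem WClosed.isClosed_quantileSet {p : ℝ} [hp : Fact (1 ≤ ENNReal.ofReal p)] {F : Set (Measure ℝ)}
    (hFmom : ∀ ν ∈ F, HasFiniteMomentP p ν) (hF : WClosed p F) :
    IsClosed (quantileSet p F) := by
  have hp0 : 0 < p := ENNReal.ofReal_pos.1 (one_pos.trans_le hp.out)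
  refine IsSeqClosed.isClosed fun f g hf hfg => ?_
  choose ν hν hfν using hf
  have hg := Lp.memLp g
  have hgmom := hasFiniteMomentP_map hp0 hg
  obtain ⟨ns, -, hns⟩ := (tendstoInMeasure_of_tendsto_Lp hfg).exists_seq_tendsto_ae
  have hquant : ∀ᵐ u ∂volume.restrict (Ioo (0 : ℝ) 1), u ∈ Ioo (0 : ℝ) 1 ∧
      Tendsto (fun i => quantile (ν (ns i)) u) atTop (𝓝 (g u)) := by
    filter_upwards [hns, ae_all_iff.2 hfν, ae_restrict_mem measurableSet_Ioo] with u hu hfu hmem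
    exact ⟨hmem, by simpa only [hfu] using hu⟩
  have hmono : MonotoneOn g {u | u ∈ Ioo (0 : ℝ) 1 ∧
      Tendsto (fun i => quantile (ν (ns i)) u) atTop (𝓝 (g u))} := by
    intro u hu v hv huv
    refine le_of_tendsto_of_tendsto' hu.2 hv.2 fun i => ?_
    have := (hFmom _ (hν (ns i))).1
    exact monotoneOn_quantile _ hu.1 hv.1 huv
  have hgq := quantile_map_ae_eq (hg.integrable hp.out) hquant hmono
  refine ⟨_, hF ν _ hν hgmom ?_, hgq.symm⟩
  simpa only [dist_eq_Wdist hp0 (hFmom _ (hν _)) hgmom (hfν _) hgq.symm] using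
    tendsto_iff_dist_tendsto_zero.1 hfg

/-- Theorem 2.8, existence and uniqueness of the Wasserstein projection.
If `p ∈ (1, ∞)` and `F ⊆ P_p(ℝ)` is nonempty, displacement convex and `W_p`-closed, then
for every `μ ∈ P_p(ℝ)` there is a unique `ν̂ ∈ F` minimizing `ν ↦ W_p(ν, μ)` over `F`. -/
theorem wasserstein_projection_exists_unique
    (p : ℝ) (hp : 1 < p)
    (F : Set (MeasureTheory.Measure ℝ)) (hne : F.Nonempty)
    (hFmom : ∀ ν ∈ F, HasFiniteMomentP p ν)
    (hconv : DisplacementConvex F)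
    (hclosed : WClosed p F)
    (μ : MeasureTheory.Measure ℝ) (hμ : HasFiniteMomentP p μ) :
    ∃! νhat : MeasureTheory.Measure ℝ,
      νhat ∈ F ∧ ∀ ν ∈ F, Wdist p νhat μ ≤ Wdist p ν μ := by
  have hp0 : 0 < p := by linarith
  have : Fact (1 ≤ ENNReal.ofReal p) := ⟨by simpa using hp.le⟩
  have hrep : ∀ {ν}, HasFiniteMomentP p ν → ∃ f : Lp ℝ (ENNReal.ofReal p)
      (volume.restrict (Ioo (0 : ℝ) 1)), f =ᵐ[volume.restrict (Ioo 0 1)] quantile ν :=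
    fun hν => ⟨_, (memLp_quantile hp0 hν).coeFn_toLp⟩
  obtain ⟨x, hx⟩ := hrep hμ
  have hneK : (quantileSet p F).Nonempty := by
    obtain ⟨ν, hν⟩ := hne
    obtain ⟨f, hf⟩ := hrep (hFmom ν hν)
    exact ⟨f, ν, hν, hf⟩
  obtain ⟨y, ⟨⟨νhat, hνhat, hy⟩, hmin⟩, huniq⟩ :=
    existsUnique_forall_dist_le_of_uniformConvex hp0
      (fun _ hε => Lp.exists_norm_sub_rpow_le _ hp hε) hneK hconv.convex_quantileSet
      (hclosed.isClosed_quantileSet hFmom) x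
  refine ⟨νhat, ⟨hνhat, fun ν hν => ?_⟩, fun ν hν => ?_⟩
  · obtain ⟨f, hf⟩ := hrep (hFmom ν hν)
    rw [← dist_eq_Wdist hp0 (hFmom _ hνhat) hμ hy hx, ← dist_eq_Wdist hp0 (hFmom _ hν) hμ hf hx]
    exact hmin f ⟨ν, hν, hf⟩
  · obtain ⟨f, hf⟩ := hrep (hFmom ν hν.1)
    have hfy : f = y := by
      refine huniq f ⟨⟨ν, hν.1, hf⟩, ?_⟩
      rintro g ⟨σ, hσ, hg⟩
      rw [dist_eq_Wdist hp0 (hFmom _ hν.1) hμ hf hx, dist_eq_Wdist hp0 (hFmom _ hσ) hμ hg hx]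
      exact hν.2 σ hσ
    subst hfy
    have := (hFmom ν hν.1).1
    have := (hFmom νhat hνhat).1
    exact eq_of_quantile_ae_eq (hf.symm.trans hy)
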